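/- Correctness of divide-and-conquer with projection on theory atoms: let {μ_i}_{i ∈ ι} be partial assignments on the theory atoms (μ_i : α_T → Option Bool) such that for every total assignment ν with F ν = true, the T-projection ν ∘ Sum.inr extends some μ_i. Let K₀ be a set of clauses, and for each i let F_i be the truth function whose value at ν is true iff F ν = true, ν ∘ Sum.inr extends μ_i, and C ν = true for every C ∈ K₀. If, for every i, BC_T(F_i) ∪ K_i rules out P(F_i), then K₀ ∪ ⋃_{i ∈ ι} K_i rules out P(F). -/

import Mathlib

/-- correctness of divide-and-conquer with projection on theory atoms:
if the partial assignments `μ i` on the theory atoms cover the T-projections of all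
propositional models of `F`, and for each `i` the set `BC_T(F_i) ∪ K i` rules out
`P(F_i)`, then `K₀ ∪ ⋃ i, K i` rules out `P(F)`. -/
theorem stmt19 {αB αT ι : Type*} (F : (αB ⊕ αT → Bool) → Bool)
    (SatT : (αT → Bool) → Prop)
    (μ : ι → αT → Option Bool)
    (K₀ : Set ((αB ⊕ αT → Bool) → Bool)) (K : ι → Set ((αB ⊕ αT → Bool) → Bool))
    (hcov : ∀ ν : αB ⊕ αT → Bool, F ν = true →
        ∃ i : ι, ∀ a b, μ i a = some b → (ν ∘ Sum.inr) a = b)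
    (hK : ∀ i : ι, ∀ ρ : αB ⊕ αT → Bool,
        ((F ρ = true ∧ (∀ a b, μ i a = some b → (ρ ∘ Sum.inr) a = b) ∧
            (∀ C ∈ K₀, C ρ = true)) ∧
          ¬ SatT (ρ ∘ Sum.inr)) →
        (∃ η : αB ⊕ αT → Bool,
            ((F η = true ∧ (∀ a b, μ i a = some b → (η ∘ Sum.inr) a = b) ∧
                (∀ C ∈ K₀, C η = true)) ∧
              SatT (η ∘ Sum.inr)) ∧
            ρ ∘ Sum.inr = η ∘ Sum.inr) ∨
        (∃ C ∈ K i, C ρ = false)) :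
    ∀ ρ : αB ⊕ αT → Bool, (F ρ = true ∧ ¬ SatT (ρ ∘ Sum.inr)) →
      ∃ C ∈ K₀ ∪ ⋃ i : ι, K i, C ρ = false := by
  rintro ρ ⟨hF, hT⟩
  by_cases h₀ : ∀ C ∈ K₀, C ρ = true
  · obtain ⟨i, hi⟩ := hcov ρ hF
    rcases hK i ρ ⟨⟨hF, hi, h₀⟩, hT⟩ with ⟨η, ⟨-, hη⟩, hρη⟩ | ⟨C, hC, hCρ⟩
    · exact absurd (hρη ▸ hη) hT
    · exact ⟨C, Or.inr (Set.mem_iUnion.2 ⟨i, hC⟩), hCρ⟩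
  · push Not at h₀
    obtain ⟨C, hC, hCρ⟩ := h₀
    exact ⟨C, Or.inl hC, Bool.eq_false_of_not_eq_true hCρ⟩
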